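/- Let V ⊆ ℂ be an open set and let u : V → ℝ be a smooth function satisfying Liouville's equation 4 ∂_z ∂_z̄ u = e^(−2u) on V. Then the function φ := ∂²_zz u + (∂_z u)² is holomorphic on V. (This is the local coordinate form of the theorem that for a metric g = e^(2u)|dz|² of negative Gauss curvature satisfying the Ricci condition Δ_g log|K_g| = 4K_g, the entropy differential P = −2(∂²_zz u + (∂_z u)²) dz² is holomorphic.) -/

import Mathlib

open Complex

/-- The Wirtinger derivative `∂_z f = (1/2)(∂_x f - i ∂_y f)`, where the partial
derivatives are taken in the sense of the real Fréchet derivative. -/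
noncomputable def wirtingerZ (f : ℂ → ℂ) (z : ℂ) : ℂ :=
  (1 / 2) * (fderiv ℝ f z 1 - Complex.I * fderiv ℝ f z Complex.I)

/-- The conjugate Wirtinger derivative `∂_z̄ f = (1/2)(∂_x f + i ∂_y f)`. -/
noncomputable def wirtingerZbar (f : ℂ → ℂ) (z : ℂ) : ℂ :=
  (1 / 2) * (fderiv ℝ f z 1 + Complex.I * fderiv ℝ f z Complex.I)

theorem contDiffAt_wirtingerZ {f : ℂ → ℂ} {z : ℂ} (hf : ContDiffAt ℝ (⊤ : ℕ∞) f z) :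
    ContDiffAt ℝ (⊤ : ℕ∞) (wirtingerZ f) z := by
  have h : ContDiffAt ℝ (⊤ : ℕ∞) (fderiv ℝ f) z := hf.fderiv_right le_rfl
  exact contDiffAt_const.mul ((h.clm_apply contDiffAt_const).sub
    (contDiffAt_const.mul (h.clm_apply contDiffAt_const)))

/-- The Wirtinger derivatives `∂_z̄` and `∂_z` commute on `C^∞` functions. -/
theorem wirtingerZbar_wirtingerZ {f : ℂ → ℂ} {z : ℂ} (hf : ContDiffAt ℝ (⊤ : ℕ∞) f z) :
    wirtingerZbar (wirtingerZ f) z = wirtingerZ (wirtingerZbar f) z := by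
  have hd : DifferentiableAt ℝ (fderiv ℝ f) z :=
    (hf.fderiv_right (m := (⊤ : ℕ∞)) le_rfl).differentiableAt (by simp)
  have hsymm : IsSymmSndFDerivAt ℝ f z :=
    hf.isSymmSndFDerivAt (by
      simpa using WithTop.coe_le_coe.2 (le_top (a := (2 : ℕ∞))))
  have happ (v : ℂ) : HasFDerivAt (fun w => fderiv ℝ f w v)
      ((fderiv ℝ (fderiv ℝ f) z).flip v) z := by
    simpa using hd.hasFDerivAt.clm_apply (hasFDerivAt_const v z)
  have hZ : HasFDerivAt (wirtingerZ f) _ z :=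
    ((happ 1).sub ((happ I).const_mul I)).const_mul (1 / 2)
  have hZbar : HasFDerivAt (wirtingerZbar f) _ z :=
    ((happ 1).add ((happ I).const_mul I)).const_mul (1 / 2)
  rw [wirtingerZbar, wirtingerZ, hZ.fderiv, hZbar.fderiv]
  simp only [smul_apply, sub_apply,
    add_apply, ContinuousLinearMap.flip_apply, smul_eq_mul]
  rw [hsymm.eq I 1]
  ring

theorem wirtingerZ_congr {f g : ℂ → ℂ} {z : ℂ} (h : f =ᶠ[nhds z] g) :
    wirtingerZ f z = wirtingerZ g z := by
  simp only [wirtingerZ, h.fderiv_eq]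

theorem wirtingerZbar_add_sq {f g : ℂ → ℂ} {z : ℂ} (hf : DifferentiableAt ℝ f z)
    (hg : DifferentiableAt ℝ g z) :
    wirtingerZbar (fun w => f w + g w ^ 2) z
      = wirtingerZbar f z + 2 * g z * wirtingerZbar g z := by
  have h := hf.hasFDerivAt.add (hg.hasFDerivAt.pow 2)
  have h' : fderiv ℝ (fun w => f w + g w ^ 2) z = _ := h.fderiv
  simp only [wirtingerZbar, h']
  simp
  ring

theorem wirtingerZ_exp_neg_two_mul {f : ℂ → ℂ} {z : ℂ} (hf : DifferentiableAt ℝ f z) :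
    wirtingerZ (fun w => exp (-2 * f w) / 4) z
      = -(1 / 2) * wirtingerZ f z * exp (-2 * f z) := by
  have h : fderiv ℝ (fun w => exp (-2 * f w) * (4 : ℂ)⁻¹) z = _ :=
    ((hf.hasFDerivAt.const_mul (-2)).cexp.mul_const (4 : ℂ)⁻¹).fderiv
  simp only [wirtingerZ, div_eq_mul_inv (exp _), h]
  simp
  ring

/-- A real-differentiable function killed by `∂_z̄` is complex differentiable. -/
theorem differentiableAt_of_wirtingerZbar_eq_zero {f : ℂ → ℂ} {z : ℂ}
    (hf : DifferentiableAt ℝ f z) (h : wirtingerZbar f z = 0) : DifferentiableAt ℂ f z := by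
  refine differentiableAt_complex_iff_differentiableAt_real.2 ⟨hf, ?_⟩
  rw [wirtingerZbar] at h
  rw [smul_eq_mul]
  linear_combination (-2 * I) * h + fderiv ℝ f z I * I_mul_I

/-- If `u` is a smooth real-valued solution of Liouville's equation
`4 ∂_z ∂_z̄ u = e^(-2u)` on an open set `V ⊆ ℂ`, then
`φ = ∂²_zz u + (∂_z u)²` is holomorphic on `V`. -/
theorem entropy_coefficient_holomorphic
    (V : Set ℂ) (hV : IsOpen V) (u : ℂ → ℝ)
    (hu : ContDiffOn ℝ (⊤ : ℕ∞) u V)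
    (hLiouville : ∀ z ∈ V,
      4 * wirtingerZ (wirtingerZbar (fun w => (u w : ℂ))) z
        = Complex.exp (-2 * (u z : ℂ))) :
    DifferentiableOn ℂ
      (fun z => wirtingerZ (wirtingerZ (fun w => (u w : ℂ))) z
        + (wirtingerZ (fun w => (u w : ℂ)) z) ^ 2) V := by
  have hU (z : ℂ) (hz : z ∈ V) : ContDiffAt ℝ (⊤ : ℕ∞) (fun w => (u w : ℂ)) z :=
    ofRealCLM.contDiff.contDiffAt.comp z (hu.contDiffAt (hV.mem_nhds hz))
  generalize hUdef : (fun w => (u w : ℂ)) = U at hU hLiouville ⊢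
  have hUapp (z : ℂ) : (u z : ℂ) = U z := congrFun hUdef z
  simp only [hUapp] at hLiouville
  intro z hz
  have hA := contDiffAt_wirtingerZ (hU z hz)
  have hAd : DifferentiableAt ℝ (wirtingerZ U) z := hA.differentiableAt (by simp)
  have hAAd : DifferentiableAt ℝ (wirtingerZ (wirtingerZ U)) z :=
    (contDiffAt_wirtingerZ hA).differentiableAt (by simp)
  have hmixed (w : ℂ) (hw : w ∈ V) :
      wirtingerZbar (wirtingerZ U) w = exp (-2 * U w) / 4 := by
    rw [wirtingerZbar_wirtingerZ (hU w hw), ← hLiouville w hw]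
    ring
  refine (differentiableAt_of_wirtingerZbar_eq_zero (hAAd.add (hAd.pow 2))
    ?_).differentiableWithinAt
  refine (wirtingerZbar_add_sq hAAd hAd).trans ?_
  rw [wirtingerZbar_wirtingerZ hA,
    wirtingerZ_congr (Filter.eventually_of_mem (hV.mem_nhds hz) hmixed),
    wirtingerZ_exp_neg_two_mul ((hU z hz).differentiableAt (by simp)), hmixed z hz]
  ring
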